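/- Full gauge invariance of the linearized Cotton tensor: for every smooth symmetric field h_{μν} : ℝ^n → ℝ (n ≥ 3) and all smooth parameters ξ_μ : ℝ^n → ℝ and φ : ℝ^n → ℝ, setting h^{ξ,φ}_{μν} = h_{μν} + ∂_μξ_ν + ∂_νξ_μ + 2φη_{μν}, one has 𝒞_{αβμ}[h^{ξ,φ}] = 𝒞_{αβμ}[h] for all indices and all points. -/

import Mathlib

noncomputable section

open MeasureTheory

/-- Minkowski metric `diag(-1,1,…,1)` on `Fin n`. -/
def eta (n : ℕ) (μ ν : Fin n) : ℝ :=
  if μ = ν then (if (μ : ℕ) = 0 then -1 else 1) else 0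

/-- Partial derivative in the coordinate direction `μ`. -/
def pd {n : ℕ} (μ : Fin n) (f : (Fin n → ℝ) → ℝ) : (Fin n → ℝ) → ℝ :=
  fun x => fderiv ℝ f x (Pi.single μ 1)

/-- A rank-2 covariant field on `ℝ^n`. -/
abbrev TensorField (n : ℕ) := Fin n → Fin n → (Fin n → ℝ) → ℝ

/-- Linearized Riemann tensor
`ℛ_{αβγδ}[h] = −(1/2)(∂_α∂_γ h_{βδ} + ∂_β∂_δ h_{αγ} − ∂_α∂_δ h_{βγ} − ∂_β∂_γ h_{αδ})`. -/
def Riem {n : ℕ} (h : TensorField n) (α β γ δ : Fin n) : (Fin n → ℝ) → ℝ :=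
  fun x => -(1/2) * (pd α (pd γ (h β δ)) x + pd β (pd δ (h α γ)) x
    - pd α (pd δ (h β γ)) x - pd β (pd γ (h α δ)) x)

/-- Linearized Ricci tensor
`ℛ_{μν}[h] = (1/2) η^{αλ}(∂_μ∂_α h_{λν} − ∂_λ∂_α h_{μν} − ∂_μ∂_ν h_{λα} + ∂_λ∂_ν h_{μα})`. -/
def Ricci {n : ℕ} (h : TensorField n) (μ ν : Fin n) : (Fin n → ℝ) → ℝ :=
  fun x => (1/2) * ∑ α, ∑ l, eta n α l *
    (pd μ (pd α (h l ν)) x - pd l (pd α (h μ ν)) x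
      - pd μ (pd ν (h l α)) x + pd l (pd ν (h μ α)) x)

/-- Linearized scalar curvature `ℛ[h] = η^{αλ}η^{μν}(∂_λ∂_ν h_{μα} − ∂_α∂_λ h_{μν})`. -/
def Scal {n : ℕ} (h : TensorField n) : (Fin n → ℝ) → ℝ :=
  fun x => ∑ α, ∑ l, ∑ μ, ∑ ν, eta n α l * eta n μ ν *
    (pd l (pd ν (h μ α)) x - pd α (pd l (h μ ν)) x)

/-- Linearized Schouten-type tensor
`𝒦_{μν}[h] = (1/(n−2))(ℛ_{μν}[h] − η_{μν}ℛ[h]/(2(n−1)))`. -/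
def Kt {n : ℕ} (h : TensorField n) (μ ν : Fin n) : (Fin n → ℝ) → ℝ :=
  fun x => (1 / ((n : ℝ) - 2)) *
    (Ricci h μ ν x - eta n μ ν * Scal h x / (2 * ((n : ℝ) - 1)))

/-- Linearized Weyl tensor
`𝒲_{αβγδ}[h] = ℛ_{αβγδ}[h] − η_{αγ}𝒦_{δβ}[h] + η_{αδ}𝒦_{γβ}[h] + η_{βγ}𝒦_{δα}[h] − η_{βδ}𝒦_{γα}[h]`. -/
def Weyl {n : ℕ} (h : TensorField n) (α β γ δ : Fin n) : (Fin n → ℝ) → ℝ :=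
  fun x => Riem h α β γ δ x - eta n α γ * Kt h δ β x + eta n α δ * Kt h γ β x
    + eta n β γ * Kt h δ α x - eta n β δ * Kt h γ α x

/-- Linearized Cotton tensor `𝒞_{αβμ}[h] = ∂_μ𝒦_{βα}[h] − ∂_β𝒦_{μα}[h]`. -/
def Cotton {n : ℕ} (h : TensorField n) (α β μ : Fin n) : (Fin n → ℝ) → ℝ :=
  fun x => pd μ (Kt h β α) x - pd β (Kt h μ α) x

/-- Cotton tensor with all indices raised:
`𝒞^{αβρ}[h] = η^{αα'}η^{ββ'}η^{ρρ'}𝒞_{α'β'ρ'}[h]`. -/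
def CottonUp {n : ℕ} (h : TensorField n) (α β ρ : Fin n) : (Fin n → ℝ) → ℝ :=
  fun x => ∑ α', ∑ β', ∑ ρ', eta n α α' * eta n β β' * eta n ρ ρ' * Cotton h α' β' ρ' x

/-- Linearized Bach tensor `ℬ^{αβ}[h] = −2∂_ρ𝒞^{αβρ}[h]`. -/
def Bach {n : ℕ} (h : TensorField n) (α β : Fin n) : (Fin n → ℝ) → ℝ :=
  fun x => -2 * ∑ ρ, pd ρ (CottonUp h α β ρ) x

lemma contDiff_pd {n : ℕ} {f : (Fin n → ℝ) → ℝ} (hf : ContDiff ℝ (⊤ : ℕ∞) f) (μ : Fin n) :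
    ContDiff ℝ (⊤ : ℕ∞) (pd μ f) :=
  (hf.fderiv_right (m := (⊤ : ℕ∞)) le_rfl).clm_apply contDiff_const

lemma differentiable_of_contDiff_top {n : ℕ} {f : (Fin n → ℝ) → ℝ}
    (hf : ContDiff ℝ (⊤ : ℕ∞) f) : Differentiable ℝ f :=
  hf.differentiable (by simp)

lemma pd_add {n : ℕ} {f g : (Fin n → ℝ) → ℝ} (hf : ContDiff ℝ (⊤ : ℕ∞) f)
    (hg : ContDiff ℝ (⊤ : ℕ∞) g) (μ : Fin n) :
    pd μ (fun x => f x + g x) = fun x => pd μ f x + pd μ g x := by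
  funext x
  simp [pd, fderiv_fun_add (differentiable_of_contDiff_top hf x)
    (differentiable_of_contDiff_top hg x)]

lemma pd_sub {n : ℕ} {f g : (Fin n → ℝ) → ℝ} (hf : ContDiff ℝ (⊤ : ℕ∞) f)
    (hg : ContDiff ℝ (⊤ : ℕ∞) g) (μ : Fin n) :
    pd μ (fun x => f x - g x) = fun x => pd μ f x - pd μ g x := by
  funext x
  simp [pd, fderiv_fun_sub (differentiable_of_contDiff_top hf x)
    (differentiable_of_contDiff_top hg x)]

lemma pd_const_mul {n : ℕ} {f : (Fin n → ℝ) → ℝ} (hf : ContDiff ℝ (⊤ : ℕ∞) f) (c : ℝ)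
    (μ : Fin n) : pd μ (fun x => c * f x) = fun x => c * pd μ f x := by
  funext x
  simp [pd, fderiv_const_mul (differentiable_of_contDiff_top hf x)]

lemma pd_pd_add {n : ℕ} {f g : (Fin n → ℝ) → ℝ} (hf : ContDiff ℝ (⊤ : ℕ∞) f)
    (hg : ContDiff ℝ (⊤ : ℕ∞) g) (μ ν : Fin n) :
    pd μ (pd ν (fun x => f x + g x)) = fun x => pd μ (pd ν f) x + pd μ (pd ν g) x := by
  rw [pd_add hf hg, pd_add (contDiff_pd hf ν) (contDiff_pd hg ν)]

lemma pd_pd_const_mul {n : ℕ} {f : (Fin n → ℝ) → ℝ} (hf : ContDiff ℝ (⊤ : ℕ∞) f) (c : ℝ)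
    (μ ν : Fin n) : pd μ (pd ν (fun x => c * f x)) = fun x => c * pd μ (pd ν f) x := by
  rw [pd_const_mul hf, pd_const_mul (contDiff_pd hf ν)]

lemma pd_pd_eq_fderiv_fderiv {n : ℕ} {f : (Fin n → ℝ) → ℝ} (hf : ContDiff ℝ (⊤ : ℕ∞) f)
    (μ ν : Fin n) (x : Fin n → ℝ) :
    pd μ (pd ν f) x = fderiv ℝ (fderiv ℝ f) x (Pi.single μ 1) (Pi.single ν 1) := by
  have hd : DifferentiableAt ℝ (fderiv ℝ f) x :=
    (hf.fderiv_right (m := (⊤ : ℕ∞)) le_rfl).differentiable (by simp) x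
  change fderiv ℝ (fun y => fderiv ℝ f y (Pi.single ν 1)) x (Pi.single μ 1) = _
  simp [fderiv_clm_apply hd (differentiableAt_const _)]

lemma pd_comm {n : ℕ} {f : (Fin n → ℝ) → ℝ} (hf : ContDiff ℝ (⊤ : ℕ∞) f) (μ ν : Fin n) :
    pd μ (pd ν f) = pd ν (pd μ f) := by
  funext x
  rw [pd_pd_eq_fderiv_fderiv hf, pd_pd_eq_fderiv_fderiv hf]
  exact (hf.contDiffAt.isSymmSndFDerivAt
    (by simpa using WithTop.coe_le_coe.2 (le_top : (2 : ℕ∞) ≤ ⊤))).eq _ _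

lemma eta_mul_self {n : ℕ} (μ : Fin n) : eta n μ μ * eta n μ μ = 1 := by
  unfold eta
  split_ifs <;> simp_all

lemma eta_comm {n : ℕ} (μ ν : Fin n) : eta n μ ν = eta n ν μ := by
  by_cases h : μ = ν
  · rw [h]
  · simp [eta, h, Ne.symm h]

lemma sum_eta_mul {n : ℕ} (μ : Fin n) (F : Fin n → ℝ) :
    ∑ ν, eta n μ ν * F ν = eta n μ μ * F μ := by
  refine Finset.sum_eq_single μ (fun ν _ h => ?_) (by simp)
  simp [eta, Ne.symm h]

lemma Ricci_eq {n : ℕ} (h : TensorField n) (μ ν : Fin n) (x : Fin n → ℝ) :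
    Ricci h μ ν x = (1 / 2) * ∑ α, eta n α α *
      (pd μ (pd α (h α ν)) x - pd α (pd α (h μ ν)) x
        - pd μ (pd ν (h α α)) x + pd α (pd ν (h μ α)) x) := by
  simp only [Ricci, sum_eta_mul]

lemma Scal_eq {n : ℕ} (h : TensorField n) (x : Fin n → ℝ) :
    Scal h x = ∑ α, ∑ μ, eta n α α * eta n μ μ *
      (pd α (pd μ (h μ α)) x - pd α (pd α (h μ μ)) x) := by
  simp only [Scal, mul_assoc, ← Finset.mul_sum, sum_eta_mul]

lemma Ricci_add {n : ℕ} {h k : TensorField n} (hh : ∀ μ ν, ContDiff ℝ (⊤ : ℕ∞) (h μ ν))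
    (hk : ∀ μ ν, ContDiff ℝ (⊤ : ℕ∞) (k μ ν)) (μ ν : Fin n) (x : Fin n → ℝ) :
    Ricci (fun μ ν x => h μ ν x + k μ ν x) μ ν x = Ricci h μ ν x + Ricci k μ ν x := by
  simp only [Ricci_eq, pd_pd_add (hh _ _) (hk _ _), ← mul_add, ← Finset.sum_add_distrib]
  congr 1
  refine Finset.sum_congr rfl fun α _ => ?_
  ring

lemma Scal_add {n : ℕ} {h k : TensorField n} (hh : ∀ μ ν, ContDiff ℝ (⊤ : ℕ∞) (h μ ν))
    (hk : ∀ μ ν, ContDiff ℝ (⊤ : ℕ∞) (k μ ν)) (x : Fin n → ℝ) :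
    Scal (fun μ ν x => h μ ν x + k μ ν x) x = Scal h x + Scal k x := by
  simp only [Scal_eq, pd_pd_add (hh _ _) (hk _ _), ← Finset.sum_add_distrib]
  refine Finset.sum_congr rfl fun α _ => Finset.sum_congr rfl fun μ _ => ?_
  ring

lemma Kt_add {n : ℕ} {h k : TensorField n} (hh : ∀ μ ν, ContDiff ℝ (⊤ : ℕ∞) (h μ ν))
    (hk : ∀ μ ν, ContDiff ℝ (⊤ : ℕ∞) (k μ ν)) (μ ν : Fin n) (x : Fin n → ℝ) :
    Kt (fun μ ν x => h μ ν x + k μ ν x) μ ν x = Kt h μ ν x + Kt k μ ν x := by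
  simp only [Kt, Ricci_add hh hk, Scal_add hh hk]
  ring

lemma contDiff_Kt {n : ℕ} {h : TensorField n} (hh : ∀ μ ν, ContDiff ℝ (⊤ : ℕ∞) (h μ ν))
    (μ ν : Fin n) : ContDiff ℝ (⊤ : ℕ∞) (Kt h μ ν) := by
  have hpd (α β μ ν : Fin n) : ContDiff ℝ (⊤ : ℕ∞) (pd α (pd β (h μ ν))) :=
    contDiff_pd (contDiff_pd (hh μ ν) β) α
  have hR : ContDiff ℝ (⊤ : ℕ∞) (Ricci h μ ν) :=
    contDiff_const.mul <| ContDiff.sum fun α _ => ContDiff.sum fun l _ => contDiff_const.mul <|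
      (((hpd _ _ _ _).sub (hpd _ _ _ _)).sub (hpd _ _ _ _)).add (hpd _ _ _ _)
  have hS : ContDiff ℝ (⊤ : ℕ∞) (Scal h) :=
    ContDiff.sum fun α _ => ContDiff.sum fun l _ => ContDiff.sum fun μ _ =>
      ContDiff.sum fun ν _ => contDiff_const.mul ((hpd _ _ _ _).sub (hpd _ _ _ _))
  exact contDiff_const.mul (hR.sub ((contDiff_const.mul hS).div_const _))

/-- The Schouten-type tensor vanishes on a linearized diffeomorphism. -/
lemma Kt_diffeo {n : ℕ} {ξ : Fin n → (Fin n → ℝ) → ℝ}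
    (hξ : ∀ μ, ContDiff ℝ (⊤ : ℕ∞) (ξ μ)) (μ ν : Fin n) (x : Fin n → ℝ) :
    Kt (fun μ ν x => pd μ (ξ ν) x + pd ν (ξ μ) x) μ ν x = 0 := by
  have swap (α β γ δ : Fin n) : pd α (pd β (pd γ (ξ δ))) = pd β (pd α (pd γ (ξ δ))) :=
    pd_comm (contDiff_pd (hξ δ) γ) α β
  have swap' (α β γ δ : Fin n) : pd α (pd β (pd γ (ξ δ))) = pd α (pd γ (pd β (ξ δ))) := by
    rw [pd_comm (hξ δ) β γ]
  have hR : Ricci (fun μ ν x => pd μ (ξ ν) x + pd ν (ξ μ) x) μ ν x = 0 := by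
    simp only [Ricci_eq, pd_pd_add (contDiff_pd (hξ _) _) (contDiff_pd (hξ _) _)]
    rw [Finset.sum_eq_zero fun α _ => ?_, mul_zero]
    rw [swap' α α μ ν, swap α μ α ν, swap' α α ν μ, swap' α ν μ α, swap α μ ν α, swap' μ α ν α]
    ring
  have hS : Scal (fun μ ν x => pd μ (ξ ν) x + pd ν (ξ μ) x) x = 0 := by
    simp only [Scal_eq, pd_pd_add (contDiff_pd (hξ _) _) (contDiff_pd (hξ _) _)]
    have key (α μ : Fin n) : eta n α α * eta n μ μ *
        (pd α (pd μ (pd μ (ξ α))) x + pd α (pd μ (pd α (ξ μ))) x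
          - (pd α (pd α (pd μ (ξ μ))) x + pd α (pd α (pd μ (ξ μ))) x))
        = eta n α α * eta n μ μ * pd μ (pd μ (pd α (ξ α))) x
          - eta n μ μ * eta n α α * pd α (pd α (pd μ (ξ μ))) x := by
      rw [swap' α μ α, swap α μ μ, swap' μ α μ]
      ring
    simp only [key, Finset.sum_sub_distrib]
    rw [sub_eq_zero, Finset.sum_comm]
  rw [Kt, hR, hS]
  ring

/-- On a linearized conformal rescaling the Schouten-type tensor is minus the Hessian. -/
lemma Kt_conformal {n : ℕ} (hn : 3 ≤ n) {φ : (Fin n → ℝ) → ℝ}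
    (hφ : ContDiff ℝ (⊤ : ℕ∞) φ) (μ ν : Fin n) (x : Fin n → ℝ) :
    Kt (fun μ ν x => 2 * φ x * eta n μ ν) μ ν x = - pd μ (pd ν φ) x := by
  have hn' : (3 : ℝ) ≤ n := by exact_mod_cast hn
  have hpd (α β μ ν : Fin n) : pd α (pd β (fun x => 2 * φ x * eta n μ ν)) =
      fun x => 2 * eta n μ ν * pd α (pd β φ) x := by
    rw [← pd_pd_const_mul hφ]
    congr 2
    funext x
    ring
  set box : ℝ := ∑ α, eta n α α * pd α (pd α φ) x with hbox
  have hR : Ricci (fun μ ν x => 2 * φ x * eta n μ ν) μ ν x =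
      -((n : ℝ) - 2) * pd μ (pd ν φ) x - eta n μ ν * box := by
    have key (α : Fin n) : eta n α α *
        (2 * eta n α ν * pd μ (pd α φ) x - 2 * eta n μ ν * pd α (pd α φ) x
          - 2 * eta n α α * pd μ (pd ν φ) x + 2 * eta n μ α * pd α (pd ν φ) x)
        = 2 * (eta n ν α * (eta n α α * pd μ (pd α φ) x))
          - 2 * eta n μ ν * (eta n α α * pd α (pd α φ) x)
          - 2 * pd μ (pd ν φ) x + 2 * (eta n μ α * (eta n α α * pd α (pd ν φ) x)) := by
      rw [eta_comm α ν]
      linear_combination (-2 * pd μ (pd ν φ) x) * eta_mul_self α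
    simp only [Ricci_eq, hpd, key, Finset.sum_add_distrib, Finset.sum_sub_distrib,
      ← Finset.mul_sum, sum_eta_mul, ← hbox]
    simp only [← mul_assoc, eta_mul_self, Finset.sum_const, Finset.card_univ, Fintype.card_fin,
      nsmul_eq_mul]
    ring
  have hS : Scal (fun μ ν x => 2 * φ x * eta n μ ν) x = -2 * ((n : ℝ) - 1) * box := by
    have key (α μ : Fin n) : eta n α α * eta n μ μ *
        (2 * eta n μ α * pd α (pd μ φ) x - 2 * eta n μ μ * pd α (pd α φ) x)
        = 2 * eta n α α * (eta n α μ * (eta n μ μ * pd α (pd μ φ) x))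
          - 2 * (eta n α α * pd α (pd α φ) x) := by
      rw [eta_comm μ α]
      linear_combination (-2 * eta n α α * pd α (pd α φ) x) * eta_mul_self μ
    have key' (α : Fin n) : 2 * eta n α α * (eta n α α * (eta n α α * pd α (pd α φ) x))
        = 2 * (eta n α α * pd α (pd α φ) x) := by
      linear_combination (2 * eta n α α * pd α (pd α φ) x) * eta_mul_self α
    simp only [Scal_eq, hpd, key, Finset.sum_sub_distrib, ← Finset.mul_sum, sum_eta_mul, key',
      Finset.sum_const, Finset.card_univ, Fintype.card_fin, nsmul_eq_mul]
    simp only [mul_left_comm _ (n : ℝ), ← Finset.mul_sum, ← hbox]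
    ring
  have h1 : (n : ℝ) - 1 ≠ 0 := by linarith
  have h2 : (n : ℝ) - 2 ≠ 0 := by linarith
  rw [Kt, hR, hS]
  field_simp
  ring

/-- full gauge invariance of the linearized Cotton tensor under
`h^{ξ,φ}_{μν} = h_{μν} + ∂_μξ_ν + ∂_νξ_μ + 2φη_{μν}`. -/
theorem cotton_tensor_gauge_invariant {n : ℕ} (hn : 3 ≤ n)
    (h : TensorField n) (hsmooth : ∀ μ ν, ContDiff ℝ (⊤ : ℕ∞) (h μ ν))
    (hsym : ∀ μ ν, h μ ν = h ν μ)
    (ξ : Fin n → (Fin n → ℝ) → ℝ) (hξ : ∀ μ, ContDiff ℝ (⊤ : ℕ∞) (ξ μ))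
    (φ : (Fin n → ℝ) → ℝ) (hφ : ContDiff ℝ (⊤ : ℕ∞) φ) :
    ∀ (α β μ : Fin n) (x : Fin n → ℝ),
      Cotton (fun μ ν x => h μ ν x + pd μ (ξ ν) x + pd ν (ξ μ) x + 2 * φ x * eta n μ ν)
          α β μ x
        = Cotton h α β μ x := by
  intro α β μ x
  have hdiff (μ ν : Fin n) :
      ContDiff ℝ (⊤ : ℕ∞) (fun x => pd μ (ξ ν) x + pd ν (ξ μ) x) :=
    (contDiff_pd (hξ ν) μ).add (contDiff_pd (hξ μ) ν)
  have hconf (μ ν : Fin n) : ContDiff ℝ (⊤ : ℕ∞) (fun x => 2 * φ x * eta n μ ν) :=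
    (contDiff_const.mul hφ).mul contDiff_const
  have hK (μ ν : Fin n) :
      Kt (fun μ ν x => h μ ν x + pd μ (ξ ν) x + pd ν (ξ μ) x + 2 * φ x * eta n μ ν) μ ν =
        fun x => Kt h μ ν x - pd μ (pd ν φ) x := by
    funext x
    simp only [add_assoc (h _ _ _) (pd _ _ _) (pd _ _ _)]
    rw [Kt_add (fun μ ν => (hsmooth μ ν).add (hdiff μ ν)) hconf, Kt_add hsmooth hdiff,
      Kt_diffeo hξ, Kt_conformal hn hφ]
    ring
  have hess (μ ν : Fin n) : ContDiff ℝ (⊤ : ℕ∞) (pd μ (pd ν φ)) :=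
    contDiff_pd (contDiff_pd hφ ν) μ
  simp only [Cotton, hK, pd_sub (contDiff_Kt hsmooth _ _) (hess _ _)]
  rw [pd_comm (contDiff_pd hφ α) μ β]
  ring
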